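/- arXiv:1902.00580 — 2 statements merged into one kernel-verified Lean document; each statement's English description precedes it below -/
import Mathlib

section
/- Let (X, Y, Z) be finite-alphabet stochastic processes on a common probability space that are jointly d-Markov. Then for every i ≥ 1 and k ≥ 1, the per-time-step partial directed information term admits the finite-window representation I(X_i; Y_{i−k}^i | X^{i−1}, Y^{i−k−1}, Z^i) = H(X_i | X_{i−k−d}^{i−1}, Y_{i−k−d}^{i−k−1}, Z_{i−k−d}^i) − H(X_i | X_{i−d}^{i−1}, Y_{i−d}^i, Z_{i−d}^i). In particular, the partial directed information depends on the joint process only through windows of length k + d and can be computed without assuming that X is conditionally Markov given Z. -/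
open MeasureTheory Finset

noncomputable section

variable {Ω : Type*}

/-- Windowed history `(X_{max(a,1)}, …, X_b)` of a process `X = (X_i)_{i ≥ 1}`, encoded
uniformly as a map `ℕ → Option α`; indices outside the window `[max(a,1), b]` (in
particular, indices below `1`) are dropped (set to `none`). -/
def blk {α : Type*} (X : ℕ → Ω → α) (a b : ℕ) : Ω → (ℕ → Option α) :=
  fun ω j => if max a 1 ≤ j ∧ j ≤ b then some (X j ω) else none

/-- Shannon entropy `H(U)` of a random variable `U`. -/
def ent [MeasurableSpace Ω] {β : Type*} (μ : Measure Ω) (U : Ω → β) : ℝ :=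
  -∑' b : β, (μ (U ⁻¹' {b})).toReal * Real.log (μ (U ⁻¹' {b})).toReal

/-- Conditional Shannon entropy `H(U ∣ V)`. -/
def condEnt [MeasurableSpace Ω] {β γ : Type*} (μ : Measure Ω) (U : Ω → β) (V : Ω → γ) : ℝ :=
  ent μ (fun ω => (U ω, V ω)) - ent μ V

/-- Conditional mutual information `I(U ; V ∣ W) = H(U ∣ W) - H(U ∣ V, W)`. -/
def cmi [MeasurableSpace Ω] {β γ δ : Type*} (μ : Measure Ω) (U : Ω → β) (V : Ω → γ)
    (W : Ω → δ) : ℝ :=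
  condEnt μ U W - condEnt μ U (fun ω => (V ω, W ω))

/-- `U` and `V` are conditionally independent given `W` (under `μ`). -/
def CondIndepRV [MeasurableSpace Ω] {β γ δ : Type*} (μ : Measure Ω) (U : Ω → β) (V : Ω → γ)
    (W : Ω → δ) : Prop :=
  ∀ (b : β) (c : γ) (w : δ),
    μ (U ⁻¹' {b} ∩ V ⁻¹' {c} ∩ W ⁻¹' {w}) * μ (W ⁻¹' {w})
      = μ (U ⁻¹' {b} ∩ W ⁻¹' {w}) * μ (V ⁻¹' {c} ∩ W ⁻¹' {w})

variable {𝒳 𝒴 𝒵 : Type*}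

/-- The joint past window `(X_{i-d}^{i-1}, Y_{i-d}^{i-1}, Z_{i-d}^{i-1})`. -/
def past (X : ℕ → Ω → 𝒳) (Y : ℕ → Ω → 𝒴) (Z : ℕ → Ω → 𝒵) (d i : ℕ) :
    Ω → (ℕ → Option 𝒳) × (ℕ → Option 𝒴) × (ℕ → Option 𝒵) :=
  fun ω => (blk X (i - d) (i - 1) ω, blk Y (i - d) (i - 1) ω, blk Z (i - d) (i - 1) ω)

/-- `(X, Y, Z)` are jointly `d`-Markov: for every `i`, `(X_i, Y_i, Z_i)` is conditionally
independent of `(X^{i-d-1}, Y^{i-d-1}, Z^{i-d-1})` given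
`(X_{i-d}^{i-1}, Y_{i-d}^{i-1}, Z_{i-d}^{i-1})`. -/
def JointlyMarkov [MeasurableSpace Ω] (μ : Measure Ω) (X : ℕ → Ω → 𝒳) (Y : ℕ → Ω → 𝒴)
    (Z : ℕ → Ω → 𝒵) (d : ℕ) : Prop :=
  ∀ i : ℕ, 1 ≤ i →
    CondIndepRV μ (fun ω => (X i ω, Y i ω, Z i ω))
      (fun ω => (blk X 1 (i - d - 1) ω, blk Y 1 (i - d - 1) ω, blk Z 1 (i - d - 1) ω))
      (past X Y Z d i)

/-- `(X, Y, Z)` are jointly stationary: all finite-dimensional joint distributions are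
invariant under index shifts. -/
def JointlyStationary [MeasurableSpace Ω] (μ : Measure Ω) (X : ℕ → Ω → 𝒳) (Y : ℕ → Ω → 𝒴)
    (Z : ℕ → Ω → 𝒵) : Prop :=
  ∀ (n : ℕ) (t : Fin n → ℕ) (a : Fin n → 𝒳 × 𝒴 × 𝒵), (∀ j, 1 ≤ t j) →
    μ (⋂ j, {ω | (X (t j) ω, Y (t j) ω, Z (t j) ω) = a j})
      = μ (⋂ j, {ω | (X (t j + 1) ω, Y (t j + 1) ω, Z (t j + 1) ω) = a j})

/-- Assumption (A1): for every `i`, the variables `X_i, Y_i, Z_i` are mutually conditionally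
independent given the joint past `(X_{i-d}^{i-1}, Y_{i-d}^{i-1}, Z_{i-d}^{i-1})` (all pairwise
factorizations together with the triple factorization). -/
def A1 [MeasurableSpace Ω] (μ : Measure Ω) (X : ℕ → Ω → 𝒳) (Y : ℕ → Ω → 𝒴)
    (Z : ℕ → Ω → 𝒵) (d : ℕ) : Prop :=
  ∀ i : ℕ, 1 ≤ i →
    CondIndepRV μ (X i) (Y i) (past X Y Z d i) ∧
    CondIndepRV μ (X i) (Z i) (past X Y Z d i) ∧
    CondIndepRV μ (Y i) (Z i) (past X Y Z d i) ∧
    ∀ (a : 𝒳) (b : 𝒴) (c : 𝒵)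
      (w : (ℕ → Option 𝒳) × (ℕ → Option 𝒴) × (ℕ → Option 𝒵)),
      μ (X i ⁻¹' {a} ∩ Y i ⁻¹' {b} ∩ Z i ⁻¹' {c} ∩ past X Y Z d i ⁻¹' {w})
          * μ (past X Y Z d i ⁻¹' {w}) * μ (past X Y Z d i ⁻¹' {w})
        = μ (X i ⁻¹' {a} ∩ past X Y Z d i ⁻¹' {w})
          * μ (Y i ⁻¹' {b} ∩ past X Y Z d i ⁻¹' {w})
          * μ (Z i ⁻¹' {c} ∩ past X Y Z d i ⁻¹' {w})

/-- The causally conditioned directed information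
`I(Y^n → X^n ‖ Z^n) = ∑_{i=1}^n I(X_i ; Y^i ∣ X^{i-1}, Z^i)`. -/
def DI [MeasurableSpace Ω] (μ : Measure Ω) (X : ℕ → Ω → 𝒳) (Y : ℕ → Ω → 𝒴)
    (Z : ℕ → Ω → 𝒵) (n : ℕ) : ℝ :=
  ∑ i ∈ Finset.Icc 1 n,
    cmi μ (X i) (blk Y 1 i) (fun ω => (blk X 1 (i - 1) ω, blk Z 1 i ω))

/-- The `k`-th order causally conditioned truncated directed information
`I_T^{(k)}(Y^n → X^n ‖ Z^n) = ∑_{i=1}^n I(X_i ; Y_{i-k}^i ∣ X_{i-k}^{i-1}, Z_{i-k}^i)`. -/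
def TDI [MeasurableSpace Ω] (μ : Measure Ω) (X : ℕ → Ω → 𝒳) (Y : ℕ → Ω → 𝒴)
    (Z : ℕ → Ω → 𝒵) (k n : ℕ) : ℝ :=
  ∑ i ∈ Finset.Icc 1 n,
    cmi μ (X i) (blk Y (i - k) i)
      (fun ω => (blk X (i - k) (i - 1) ω, blk Z (i - k) i ω))

/-- The `k`-th order causally conditioned partial directed information
`I_P^{(k)}(Y^n → X^n ‖ Z^n) = ∑_{i=1}^n I(X_i ; Y_{i-k}^i ∣ X^{i-1}, Y^{i-k-1}, Z^i)`. -/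
def PDI [MeasurableSpace Ω] (μ : Measure Ω) (X : ℕ → Ω → 𝒳) (Y : ℕ → Ω → 𝒴)
    (Z : ℕ → Ω → 𝒵) (k n : ℕ) : ℝ :=
  ∑ i ∈ Finset.Icc 1 n,
    cmi μ (X i) (blk Y (i - k) i)
      (fun ω => (blk X 1 (i - 1) ω, blk Y 1 (i - k - 1) ω, blk Z 1 i ω))

section Entropy

variable [MeasurableSpace Ω] {α β γ α' β' γ' : Type*}

/-- A random variable has the entropy of the quotient map onto its fibres. -/
lemma ent_eq_ent_quotient (μ : Measure Ω) (U : Ω → β) :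
    ent μ U = ent μ (Quotient.mk (Setoid.ker U)) := by
  unfold ent
  have hpre : ∀ q : Quotient (Setoid.ker U),
      U ⁻¹' {Setoid.kerLift U q} = Quotient.mk (Setoid.ker U) ⁻¹' {q} := by
    intro q
    induction q using Quotient.inductionOn with
    | h a =>
      ext ω
      simp [Quotient.eq, Setoid.ker_def]
  rw [← (Setoid.kerLift_injective U).tsum_eq]
  · simp only [hpre]
  · intro b hb
    by_contra hr
    apply hb
    have : U ⁻¹' {b} = ∅ := by
      ext ω
      simp only [Set.mem_preimage, Set.mem_singleton_iff, Set.mem_empty_iff_false, iff_false]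
      exact fun h => hr ⟨Quotient.mk _ ω, h⟩
    simp [this]

/-- Entropy depends only on the partition of `Ω` into fibres. -/
lemma ent_congr (μ : Measure Ω) {U : Ω → β} {V : Ω → γ}
    (h : ∀ ω ω', U ω = U ω' ↔ V ω = V ω') : ent μ U = ent μ V := by
  rw [ent_eq_ent_quotient μ U, ent_eq_ent_quotient μ V]
  have : Setoid.ker U = Setoid.ker V :=
    Setoid.ext fun ω ω' => by simpa [Setoid.ker_def] using h ω ω'
  rw [this]

/-- Conditional independence depends only on the partitions into fibres. -/
lemma CondIndepRV.congr {μ : Measure Ω} {U : Ω → α} {V : Ω → β} {W : Ω → γ}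
    {U' : Ω → α'} {V' : Ω → β'} {W' : Ω → γ'} (h : CondIndepRV μ U V W)
    (hU : ∀ ω ω', U ω = U ω' ↔ U' ω = U' ω') (hV : ∀ ω ω', V ω = V ω' ↔ V' ω = V' ω')
    (hW : ∀ ω ω', W ω = W ω' ↔ W' ω = W' ω') : CondIndepRV μ U' V' W' := by
  intro b c w
  by_cases hb : ∃ ω, U' ω = b
  · by_cases hc : ∃ ω, V' ω = c
    · by_cases hw : ∃ ω, W' ω = w
      · obtain ⟨x, rfl⟩ := hb
        obtain ⟨y, rfl⟩ := hc
        obtain ⟨z, rfl⟩ := hw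
        have e1 : U' ⁻¹' {U' x} = U ⁻¹' {U x} := Set.ext fun ω' => (hU ω' x).symm
        have e2 : V' ⁻¹' {V' y} = V ⁻¹' {V y} := Set.ext fun ω' => (hV ω' y).symm
        have e3 : W' ⁻¹' {W' z} = W ⁻¹' {W z} := Set.ext fun ω' => (hW ω' z).symm
        rw [e1, e2, e3]
        exact h _ _ _
      · simp [Set.preimage_singleton_eq_empty.2 hw]
    · simp [Set.preimage_singleton_eq_empty.2 hc]
  · simp [Set.preimage_singleton_eq_empty.2 hb]

lemma sum_measureReal_preimage_inter (μ : Measure Ω) [IsFiniteMeasure μ] [Fintype β]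
    [MeasurableSpace β] [MeasurableSingletonClass β] {U : Ω → β} (hU : Measurable U) (E : Set Ω) :
    ∑ b, μ.real (U ⁻¹' {b} ∩ E) = μ.real E := by
  have h := sum_measureReal_preimage_singleton (μ := μ.restrict E) (Finset.univ : Finset β)
    (f := U) (fun y _ => hU (measurableSet_singleton y))
  simpa [measureReal_restrict_apply, hU (measurableSet_singleton _)] using h

lemma sum_measureReal_inter_preimage_inter (μ : Measure Ω) [IsFiniteMeasure μ] [Fintype β]
    [MeasurableSpace β] [MeasurableSingletonClass β] {U : Ω → β} (hU : Measurable U)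
    (E F : Set Ω) : ∑ b, μ.real (E ∩ U ⁻¹' {b} ∩ F) = μ.real (E ∩ F) := by
  rw [← sum_measureReal_preimage_inter μ hU (E ∩ F)]
  exact Finset.sum_congr rfl fun b _ => by rw [Set.inter_comm E, Set.inter_assoc]

/-- Nonnegativity of conditional mutual information for a finite nonnegative array. -/
lemma sum_mul_log_cmi_nonneg [Fintype α] [Fintype β] [Fintype γ] (p : α → β → γ → ℝ)
    (hp : ∀ a b c, 0 ≤ p a b c) :
    0 ≤ ∑ a, ∑ b, ∑ c, p a b c * (Real.log (p a b c) + Real.log (∑ a', ∑ b', p a' b' c)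
      - Real.log (∑ b', p a b' c) - Real.log (∑ a', p a' b c)) := by
  set pC : γ → ℝ := fun c => ∑ a', ∑ b', p a' b' c with hpC
  set pA : α → γ → ℝ := fun a c => ∑ b', p a b' c with hpA
  set pB : β → γ → ℝ := fun b c => ∑ a', p a' b c with hpB
  have hA0 : ∀ a c, 0 ≤ pA a c := fun a c => Finset.sum_nonneg fun b _ => hp a b c
  have hpA_le : ∀ a b c, p a b c ≤ pA a c := fun a b c =>
    Finset.single_le_sum (f := fun b' => p a b' c) (fun b' _ => hp a b' c) (Finset.mem_univ b)
  have hpB_le : ∀ a b c, p a b c ≤ pB b c := fun a b c =>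
    Finset.single_le_sum (f := fun a' => p a' b c) (fun a' _ => hp a' b c) (Finset.mem_univ a)
  have hpC_le : ∀ a c, pA a c ≤ pC c := fun a c =>
    Finset.single_le_sum (f := fun a' => pA a' c) (fun a' _ => hA0 a' c) (Finset.mem_univ a)
  have hterm : ∀ a b c, p a b c - pA a c * pB b c / pC c ≤
      p a b c * (Real.log (p a b c) + Real.log (pC c) - Real.log (pA a c) - Real.log (pB b c)) := by
    intro a b c
    rcases (hp a b c).eq_or_lt with h0 | h0
    · have hB0 : 0 ≤ pB b c := h0.le.trans (hpB_le a b c)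
      have hC0 : 0 ≤ pC c := (hA0 a c).trans (hpC_le a c)
      rw [← h0]
      have : 0 ≤ pA a c * pB b c / pC c := div_nonneg (mul_nonneg (hA0 a c) hB0) hC0
      linarith
    · have h1 : 0 < pA a c := h0.trans_le (hpA_le a b c)
      have h2 : 0 < pB b c := h0.trans_le (hpB_le a b c)
      have h3 : 0 < pC c := h1.trans_le (hpC_le a c)
      have hlog := Real.log_le_sub_one_of_pos
        (show 0 < pA a c * pB b c / (pC c * p a b c) by positivity)
      rw [Real.log_div (by positivity) (by positivity), Real.log_mul h1.ne' h2.ne',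
        Real.log_mul h3.ne' h0.ne'] at hlog
      have hmul := mul_le_mul_of_nonneg_left hlog h0.le
      have hdiv : p a b c * (pA a c * pB b c / (pC c * p a b c) - 1)
          = pA a c * pB b c / pC c - p a b c := by field_simp
      rw [hdiv] at hmul
      linarith
  refine le_trans ?_ (Finset.sum_le_sum fun a _ => Finset.sum_le_sum fun b _ =>
    Finset.sum_le_sum fun c _ => hterm a b c)
  simp only [Finset.sum_sub_distrib]
  have hsum1 : ∑ a, ∑ b, ∑ c, p a b c = ∑ c, pC c := by
    simp only [hpC]
    rw [Finset.sum_comm (s := (Finset.univ : Finset γ))]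
    refine Finset.sum_congr rfl fun a _ => ?_
    rw [Finset.sum_comm]
  have hsum2 : ∑ a, ∑ b, ∑ c, pA a c * pB b c / pC c = ∑ c, pC c := by
    calc ∑ a, ∑ b, ∑ c, pA a c * pB b c / pC c
        = ∑ a, ∑ c, pA a c * pC c / pC c := by
          refine Finset.sum_congr rfl fun a _ => ?_
          rw [Finset.sum_comm]
          refine Finset.sum_congr rfl fun c _ => ?_
          rw [← Finset.sum_div, ← Finset.mul_sum]
          congr 2
          exact Finset.sum_comm
      _ = ∑ c, pC c := by
          rw [Finset.sum_comm]
          refine Finset.sum_congr rfl fun c _ => ?_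
          rw [← Finset.sum_div, ← Finset.sum_mul]
          exact mul_self_div_self (pC c)
  rw [hsum1, hsum2, sub_self]

variable [Fintype α] [MeasurableSpace α] [MeasurableSingletonClass α]
  [Fintype β] [MeasurableSpace β] [MeasurableSingletonClass β]
  [Fintype γ]

/-- The entropy form of conditional mutual information as one sum over the joint alphabet. -/
lemma ent_add_sub_eq_sum (μ : Measure Ω) [IsFiniteMeasure μ] {A : Ω → α} {B : Ω → β} {C : Ω → γ}
    (hA : Measurable A) (hB : Measurable B) :
    ent μ (fun ω => (A ω, C ω)) + ent μ (fun ω => (B ω, C ω))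
      - ent μ (fun ω => (A ω, B ω, C ω)) - ent μ C
    = ∑ a, ∑ b, ∑ c, μ.real (A ⁻¹' {a} ∩ B ⁻¹' {b} ∩ C ⁻¹' {c}) *
        (Real.log (μ.real (A ⁻¹' {a} ∩ B ⁻¹' {b} ∩ C ⁻¹' {c})) + Real.log (μ.real (C ⁻¹' {c}))
          - Real.log (μ.real (A ⁻¹' {a} ∩ C ⁻¹' {c}))
          - Real.log (μ.real (B ⁻¹' {b} ∩ C ⁻¹' {c}))) := by
  have hAC : ∀ a c, (fun ω => (A ω, C ω)) ⁻¹' {(a, c)} = A ⁻¹' {a} ∩ C ⁻¹' {c} := by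
    intro a c
    ext ω
    simp
  have hBC : ∀ b c, (fun ω => (B ω, C ω)) ⁻¹' {(b, c)} = B ⁻¹' {b} ∩ C ⁻¹' {c} := by
    intro b c
    ext ω
    simp
  have hABC : ∀ a b c, (fun ω => (A ω, B ω, C ω)) ⁻¹' {(a, b, c)}
      = A ⁻¹' {a} ∩ B ⁻¹' {b} ∩ C ⁻¹' {c} := by
    intro a b c
    ext ω
    simp [and_assoc]
  have mAC : ∀ a c, ∑ b, μ.real (A ⁻¹' {a} ∩ B ⁻¹' {b} ∩ C ⁻¹' {c})
      = μ.real (A ⁻¹' {a} ∩ C ⁻¹' {c}) := fun a c => sum_measureReal_inter_preimage_inter μ hB _ _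
  have mBC : ∀ b c, ∑ a, μ.real (A ⁻¹' {a} ∩ B ⁻¹' {b} ∩ C ⁻¹' {c})
      = μ.real (B ⁻¹' {b} ∩ C ⁻¹' {c}) := fun b c => by
    simpa only [Set.inter_assoc] using sum_measureReal_preimage_inter μ hA (B ⁻¹' {b} ∩ C ⁻¹' {c})
  have mC : ∀ c, ∑ b, μ.real (B ⁻¹' {b} ∩ C ⁻¹' {c}) = μ.real (C ⁻¹' {c}) := fun c =>
    sum_measureReal_preimage_inter μ hB _
  have eAC : ent μ (fun ω => (A ω, C ω)) = -∑ a, ∑ b, ∑ c,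
      μ.real (A ⁻¹' {a} ∩ B ⁻¹' {b} ∩ C ⁻¹' {c}) * Real.log (μ.real (A ⁻¹' {a} ∩ C ⁻¹' {c})) := by
    rw [ent, tsum_fintype, Fintype.sum_prod_type, neg_inj]
    refine Finset.sum_congr rfl fun a _ => ?_
    rw [Finset.sum_comm]
    refine Finset.sum_congr rfl fun c _ => ?_
    rw [← Finset.sum_mul, mAC, hAC]
    rfl
  have eBC : ent μ (fun ω => (B ω, C ω)) = -∑ a, ∑ b, ∑ c,
      μ.real (A ⁻¹' {a} ∩ B ⁻¹' {b} ∩ C ⁻¹' {c}) * Real.log (μ.real (B ⁻¹' {b} ∩ C ⁻¹' {c})) := by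
    rw [ent, tsum_fintype, Fintype.sum_prod_type, neg_inj,
      Finset.sum_comm (s := (Finset.univ : Finset α))]
    refine Finset.sum_congr rfl fun b _ => ?_
    rw [Finset.sum_comm (s := (Finset.univ : Finset α))]
    refine Finset.sum_congr rfl fun c _ => ?_
    rw [← Finset.sum_mul, mBC, hBC]
    rfl
  have eC : ent μ C = -∑ a, ∑ b, ∑ c,
      μ.real (A ⁻¹' {a} ∩ B ⁻¹' {b} ∩ C ⁻¹' {c}) * Real.log (μ.real (C ⁻¹' {c})) := by
    rw [ent, tsum_fintype, neg_inj, Finset.sum_comm]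
    simp only [Finset.sum_comm (s := (Finset.univ : Finset α)), ← Finset.sum_mul, mBC]
    rw [Finset.sum_comm]
    simp only [← Finset.sum_mul, mC]
    rfl
  have eABC : ent μ (fun ω => (A ω, B ω, C ω)) = -∑ a, ∑ b, ∑ c,
      μ.real (A ⁻¹' {a} ∩ B ⁻¹' {b} ∩ C ⁻¹' {c}) *
        Real.log (μ.real (A ⁻¹' {a} ∩ B ⁻¹' {b} ∩ C ⁻¹' {c})) := by
    rw [ent, tsum_fintype]
    simp only [Fintype.sum_prod_type, hABC]
    rfl
  rw [eAC, eBC, eC, eABC]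
  simp only [mul_sub, mul_add, Finset.sum_sub_distrib, Finset.sum_add_distrib]
  ring

/-- Submodularity of entropy. -/
lemma ent_submodular (μ : Measure Ω) [IsFiniteMeasure μ] {A : Ω → α} {B : Ω → β} {C : Ω → γ}
    (hA : Measurable A) (hB : Measurable B) :
    ent μ (fun ω => (A ω, B ω, C ω)) + ent μ C
      ≤ ent μ (fun ω => (A ω, C ω)) + ent μ (fun ω => (B ω, C ω)) := by
  have h := sum_mul_log_cmi_nonneg
    (fun a b c => μ.real (A ⁻¹' {a} ∩ B ⁻¹' {b} ∩ C ⁻¹' {c})) (fun _ _ _ => measureReal_nonneg)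
  have mAC : ∀ a c, ∑ b, μ.real (A ⁻¹' {a} ∩ B ⁻¹' {b} ∩ C ⁻¹' {c})
      = μ.real (A ⁻¹' {a} ∩ C ⁻¹' {c}) := fun a c => sum_measureReal_inter_preimage_inter μ hB _ _
  have mBC : ∀ b c, ∑ a, μ.real (A ⁻¹' {a} ∩ B ⁻¹' {b} ∩ C ⁻¹' {c})
      = μ.real (B ⁻¹' {b} ∩ C ⁻¹' {c}) := fun b c => by
    simpa only [Set.inter_assoc] using sum_measureReal_preimage_inter μ hA (B ⁻¹' {b} ∩ C ⁻¹' {c})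
  simp only [mAC, mBC, sum_measureReal_preimage_inter μ hA] at h
  rw [← ent_add_sub_eq_sum μ hA hB] at h
  linarith

/-- Conditional independence is equality in the submodularity of entropy. -/
lemma CondIndepRV.ent_add_eq {μ : Measure Ω} [IsFiniteMeasure μ]
    {A : Ω → α} {B : Ω → β} {C : Ω → γ} (h : CondIndepRV μ A B C)
    (hA : Measurable A) (hB : Measurable B) :
    ent μ (fun ω => (A ω, B ω, C ω)) + ent μ C
      = ent μ (fun ω => (A ω, C ω)) + ent μ (fun ω => (B ω, C ω)) := by
  have hzero : ent μ (fun ω => (A ω, C ω)) + ent μ (fun ω => (B ω, C ω))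
      - ent μ (fun ω => (A ω, B ω, C ω)) - ent μ C = 0 := by
    rw [ent_add_sub_eq_sum μ hA hB]
    refine Finset.sum_eq_zero fun a _ => Finset.sum_eq_zero fun b _ =>
      Finset.sum_eq_zero fun c _ => ?_
    have hreal : μ.real (A ⁻¹' {a} ∩ B ⁻¹' {b} ∩ C ⁻¹' {c}) * μ.real (C ⁻¹' {c})
        = μ.real (A ⁻¹' {a} ∩ C ⁻¹' {c}) * μ.real (B ⁻¹' {b} ∩ C ⁻¹' {c}) := by
      simpa [Measure.real] using congrArg ENNReal.toReal (h a b c)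
    rcases eq_or_ne (μ.real (A ⁻¹' {a} ∩ B ⁻¹' {b} ∩ C ⁻¹' {c})) 0 with h0 | h0
    · rw [h0, zero_mul]
    · have hpos : 0 < μ.real (A ⁻¹' {a} ∩ B ⁻¹' {b} ∩ C ⁻¹' {c}) :=
        lt_of_le_of_ne measureReal_nonneg h0.symm
      have h1 : 0 < μ.real (A ⁻¹' {a} ∩ C ⁻¹' {c}) := hpos.trans_le
        (measureReal_mono (Set.inter_subset_inter_left _ Set.inter_subset_left))
      have h2 : 0 < μ.real (B ⁻¹' {b} ∩ C ⁻¹' {c}) := hpos.trans_le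
        (measureReal_mono (Set.inter_subset_inter_left _ Set.inter_subset_right))
      have h3 : 0 < μ.real (C ⁻¹' {c}) := h1.trans_le (measureReal_mono Set.inter_subset_right)
      have hlog := congrArg Real.log hreal
      rw [Real.log_mul h0 h3.ne', Real.log_mul h1.ne' h2.ne'] at hlog
      rw [hlog]
      ring
  linarith

end Entropy

section Windows

/-- The index set of the window `[max a 1, b]`. -/
def window (a b : ℕ) : Finset ℕ := Finset.Icc (max a 1) b

@[simp]
lemma mem_window {a b j : ℕ} : j ∈ window a b ↔ (a ≤ j ∧ 1 ≤ j) ∧ j ≤ b := by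
  simp [window]

/-- The window `[max a 1, b]` in all three processes. -/
def window₃ (a b : ℕ) : Finset ℕ × Finset ℕ × Finset ℕ := (window a b, window a b, window a b)

lemma window_mono {a a' b b' : ℕ} (ha : a' ≤ a) (hb : b ≤ b') : window a b ≤ window a' b' := by
  intro j
  simp only [mem_window]
  omega

lemma window₃_mono {a a' b b' : ℕ} (ha : a' ≤ a) (hb : b ≤ b') :
    window₃ a b ≤ window₃ a' b' :=
  ⟨window_mono ha hb, window_mono ha hb, window_mono ha hb⟩

/-- Two overlapping or adjacent windows combine into one. -/
lemma window_sup {a b a' b' : ℕ} (ha : a ≤ max a' 1) (hab : a' ≤ b + 1) (hb : b ≤ b') :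
    window a b ⊔ window a' b' = window a b' := by
  ext j
  simp only [Finset.sup_eq_union, Finset.mem_union, mem_window]
  omega

lemma window₃_sup {a b a' b' : ℕ} (ha : a ≤ max a' 1) (hab : a' ≤ b + 1) (hb : b ≤ b') :
    window₃ a b ⊔ window₃ a' b' = window₃ a b' := by
  simp only [window₃, Prod.mk_sup_mk, window_sup ha hab hb]

variable {h : Finset ℕ × Finset ℕ × Finset ℕ → ℝ} {d : ℕ}

/-- The gap `h (s ⊔ p) - h s` of a submodular function decreases in `s`. -/
lemma gap_antitone (hsub : ∀ s t u, h (s ⊔ t ⊔ u) + h u ≤ h (s ⊔ u) + h (t ⊔ u))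
    (p : Finset ℕ × Finset ℕ × Finset ℕ) {u s : Finset ℕ × Finset ℕ × Finset ℕ} (hus : u ≤ s) :
    h (s ⊔ p) - h s ≤ h (u ⊔ p) - h u := by
  have := hsub s p u
  rw [sup_right_comm, sup_eq_left.2 hus, sup_comm p u] at this
  linarith

/-- For a submodular function with the `d`-Markov property, the gap between the full past and a
window reaching `d` steps before time `a` does not change from time `a - 1` on. -/
lemma markov_gap_eq (hsub : ∀ s t u, h (s ⊔ t ⊔ u) + h u ≤ h (s ⊔ u) + h (t ⊔ u))
    (hmar : ∀ j, 1 ≤ j → h (window₃ (j - d) j) - h (window₃ (j - d) (j - 1))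
      = h (window₃ 1 j) - h (window₃ 1 (j - 1))) {a j : ℕ} (haj : a - 1 ≤ j) :
    h (window₃ 1 j) - h (window₃ (a - d) j)
      = h (window₃ 1 (a - 1)) - h (window₃ (a - d) (a - 1)) := by
  induction j, haj using Nat.le_induction with
  | base => rfl
  | succ j haj ih =>
    have hm := hmar (j + 1) (by omega)
    have h1 := gap_antitone hsub (window₃ (j + 1 - d) (j + 1))
      (window₃_mono (a := j + 1 - d) (a' := a - d) (by omega) (le_refl j))
    have h2 := gap_antitone hsub (window₃ (a - d) (j + 1))
      (u := window₃ (a - d) j) (s := window₃ (a - d) j ⊔ window₃ 1 j) le_sup_left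
    have e : window₃ (a - d) j ⊔ window₃ 1 j = window₃ 1 j := by
      ext x <;> simp [window₃] <;> omega
    rw [window₃_sup (by omega) (by omega) (by omega),
      window₃_sup (by omega) (by omega) (by omega)] at h1
    rw [e, window₃_sup (by omega) (by omega) (by omega),
      window₃_sup (by omega) (by omega) (by omega)] at h2
    simp only [Nat.add_sub_cancel] at hm
    linarith

/-- Enlarging a conditioning set that contains the window `[a - d, a - 1]` by the whole past up to
time `a - 1` leaves conditional increments unchanged. -/
lemma markov_increment_eq (hsub : ∀ s t u, h (s ⊔ t ⊔ u) + h u ≤ h (s ⊔ u) + h (t ⊔ u))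
    (hmar : ∀ j, 1 ≤ j → h (window₃ (j - d) j) - h (window₃ (j - d) (j - 1))
      = h (window₃ 1 j) - h (window₃ 1 (j - 1))) {a i : ℕ} (hai : a ≤ i)
    {s x : Finset ℕ × Finset ℕ × Finset ℕ} (hs : window₃ (a - d) (a - 1) ≤ s)
    (hx : s ⊔ x ≤ window₃ (a - d) i) :
    h (s ⊔ x ⊔ window₃ 1 (a - 1)) - h (s ⊔ window₃ 1 (a - 1)) = h (s ⊔ x) - h s := by
  have h1 := gap_antitone hsub (window₃ 1 (a - 1)) hs
  have h2 := gap_antitone hsub (window₃ 1 (a - 1)) (le_sup_left : s ≤ s ⊔ x)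
  have h3 := gap_antitone hsub (window₃ 1 (a - 1)) hx
  have e1 : window₃ (a - d) (a - 1) ⊔ window₃ 1 (a - 1) = window₃ 1 (a - 1) := by
    ext x <;> simp [window₃] <;> omega
  have e2 : window₃ (a - d) i ⊔ window₃ 1 (a - 1) = window₃ 1 i := by
    ext x <;> simp [window₃] <;> omega
  rw [e1] at h1
  rw [e2] at h3
  have := markov_gap_eq hsub hmar (a := a) (j := i) (by omega)
  linarith

end Windows

section JointEntropy

/-- The joint random variable of the coordinates of `(X, Y, Z)` listed in `s`. -/
def jointRV (X : ℕ → Ω → 𝒳) (Y : ℕ → Ω → 𝒴) (Z : ℕ → Ω → 𝒵)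
    (s : Finset ℕ × Finset ℕ × Finset ℕ) : Ω → (s.1 → 𝒳) × (s.2.1 → 𝒴) × (s.2.2 → 𝒵) :=
  fun ω => (fun j => X j ω, fun j => Y j ω, fun j => Z j ω)

lemma jointRV_eq_iff {X : ℕ → Ω → 𝒳} {Y : ℕ → Ω → 𝒴} {Z : ℕ → Ω → 𝒵}
    {s : Finset ℕ × Finset ℕ × Finset ℕ} {ω ω' : Ω} :
    jointRV X Y Z s ω = jointRV X Y Z s ω' ↔ (∀ j ∈ s.1, X j ω = X j ω') ∧
      (∀ j ∈ s.2.1, Y j ω = Y j ω') ∧ (∀ j ∈ s.2.2, Z j ω = Z j ω') := by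
  simp [jointRV, funext_iff]

lemma jointRV_sup_eq_iff {X : ℕ → Ω → 𝒳} {Y : ℕ → Ω → 𝒴} {Z : ℕ → Ω → 𝒵}
    {s t : Finset ℕ × Finset ℕ × Finset ℕ} {ω ω' : Ω} :
    jointRV X Y Z (s ⊔ t) ω = jointRV X Y Z (s ⊔ t) ω' ↔
      jointRV X Y Z s ω = jointRV X Y Z s ω' ∧ jointRV X Y Z t ω = jointRV X Y Z t ω' := by
  rw [jointRV_eq_iff, jointRV_eq_iff, jointRV_eq_iff]
  simp only [Prod.fst_sup, Prod.snd_sup, Finset.sup_eq_union, Finset.mem_union,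
    or_imp, forall_and]
  tauto

lemma blk_eq_iff {α : Type*} {X : ℕ → Ω → α} {a b : ℕ} {ω ω' : Ω} :
    blk X a b ω = blk X a b ω' ↔ ∀ j ∈ window a b, X j ω = X j ω' := by
  simp only [funext_iff, blk, window]
  refine forall_congr' fun j => ?_
  simp only [← Finset.mem_Icc]
  split_ifs with hj <;> simp [hj]

variable [MeasurableSpace Ω] {X : ℕ → Ω → 𝒳} {Y : ℕ → Ω → 𝒴} {Z : ℕ → Ω → 𝒵}

lemma ent_jointRV_sup (μ : Measure Ω) (s t : Finset ℕ × Finset ℕ × Finset ℕ) :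
    ent μ (jointRV X Y Z (s ⊔ t)) = ent μ (fun ω => (jointRV X Y Z s ω, jointRV X Y Z t ω)) :=
  ent_congr μ fun ω ω' => by simp only [jointRV_sup_eq_iff, Prod.mk.injEq]

lemma ent_jointRV_sup_sup (μ : Measure Ω) (s t u : Finset ℕ × Finset ℕ × Finset ℕ) :
    ent μ (jointRV X Y Z (s ⊔ t ⊔ u))
      = ent μ (fun ω => (jointRV X Y Z s ω, jointRV X Y Z t ω, jointRV X Y Z u ω)) :=
  ent_congr μ fun ω ω' => by
    simp only [jointRV_sup_eq_iff, Prod.mk.injEq, and_assoc]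

/-- Conditional entropy of `X_i` as an increment of the joint entropy. -/
lemma condEnt_eq_ent_jointRV {δ : Type*} (μ : Measure Ω) (i : ℕ) {W : Ω → δ}
    {s : Finset ℕ × Finset ℕ × Finset ℕ}
    (hW : ∀ ω ω', W ω = W ω' ↔ jointRV X Y Z s ω = jointRV X Y Z s ω') :
    condEnt μ (X i) W = ent μ (jointRV X Y Z (s ⊔ ({i}, ∅, ∅))) - ent μ (jointRV X Y Z s) := by
  rw [condEnt, ent_congr μ hW]
  congr 1
  refine ent_congr μ fun ω ω' => ?_
  rw [jointRV_sup_eq_iff, Prod.mk.injEq, hW, and_comm,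
    jointRV_eq_iff (s := ({i}, ∅, ∅))]
  simp

variable [MeasurableSpace 𝒳] [MeasurableSpace 𝒴] [MeasurableSpace 𝒵]

lemma measurable_jointRV (hX : ∀ i, Measurable (X i)) (hY : ∀ i, Measurable (Y i))
    (hZ : ∀ i, Measurable (Z i)) (s : Finset ℕ × Finset ℕ × Finset ℕ) :
    Measurable (jointRV X Y Z s) := by
  unfold jointRV
  fun_prop

variable [MeasurableSingletonClass 𝒳] [Fintype 𝒳] [MeasurableSingletonClass 𝒴] [Fintype 𝒴]
  [MeasurableSingletonClass 𝒵] [Fintype 𝒵]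

lemma ent_jointRV_submodular (μ : Measure Ω) [IsFiniteMeasure μ] (hX : ∀ i, Measurable (X i))
    (hY : ∀ i, Measurable (Y i)) (hZ : ∀ i, Measurable (Z i))
    (s t u : Finset ℕ × Finset ℕ × Finset ℕ) :
    ent μ (jointRV X Y Z (s ⊔ t ⊔ u)) + ent μ (jointRV X Y Z u)
      ≤ ent μ (jointRV X Y Z (s ⊔ u)) + ent μ (jointRV X Y Z (t ⊔ u)) := by
  rw [ent_jointRV_sup_sup, ent_jointRV_sup, ent_jointRV_sup]
  exact ent_submodular μ (measurable_jointRV hX hY hZ s) (measurable_jointRV hX hY hZ t)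

/-- The `d`-Markov property in terms of entropies of windows. -/
lemma JointlyMarkov.ent_increment_eq {μ : Measure Ω} [IsFiniteMeasure μ] {d : ℕ}
    (hmarkov : JointlyMarkov μ X Y Z d) (hX : ∀ i, Measurable (X i))
    (hY : ∀ i, Measurable (Y i)) (hZ : ∀ i, Measurable (Z i)) {j : ℕ} (hj : 1 ≤ j) :
    ent μ (jointRV X Y Z (window₃ (j - d) j)) - ent μ (jointRV X Y Z (window₃ (j - d) (j - 1)))
      = ent μ (jointRV X Y Z (window₃ 1 j)) - ent μ (jointRV X Y Z (window₃ 1 (j - 1))) := by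
  have hci : CondIndepRV μ (jointRV X Y Z (window₃ j j)) (jointRV X Y Z (window₃ 1 (j - d - 1)))
      (jointRV X Y Z (window₃ (j - d) (j - 1))) := by
    refine (hmarkov j hj).congr ?_ ?_ ?_ <;> intro ω ω'
    · have : window j j = {j} := by
        ext x
        simp only [mem_window, Finset.mem_singleton]
        omega
      rw [jointRV_eq_iff]
      simp [window₃, this]
    · rw [jointRV_eq_iff]
      simp only [window₃, Prod.mk.injEq, blk_eq_iff]
    · rw [jointRV_eq_iff]
      simp only [window₃, past, Prod.mk.injEq, blk_eq_iff]
  have hent := hci.ent_add_eq (measurable_jointRV hX hY hZ _) (measurable_jointRV hX hY hZ _)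
  have e1 : window₃ (j - d) j = window₃ j j ⊔ window₃ (j - d) (j - 1) := by
    ext x <;> simp [window₃] <;> omega
  have e2 : window₃ 1 (j - 1) = window₃ 1 (j - d - 1) ⊔ window₃ (j - d) (j - 1) := by
    ext x <;> simp [window₃] <;> omega
  have e3 : window₃ 1 j
      = window₃ j j ⊔ window₃ 1 (j - d - 1) ⊔ window₃ (j - d) (j - 1) := by
    ext x <;> simp [window₃] <;> omega
  have c1 := ent_jointRV_sup (X := X) (Y := Y) (Z := Z) μ (window₃ j j) (window₃ (j - d) (j - 1))
  have c2 := ent_jointRV_sup (X := X) (Y := Y) (Z := Z) μ (window₃ 1 (j - d - 1))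
    (window₃ (j - d) (j - 1))
  have c3 := ent_jointRV_sup_sup (X := X) (Y := Y) (Z := Z) μ (window₃ j j)
    (window₃ 1 (j - d - 1)) (window₃ (j - d) (j - 1))
  rw [← e1] at c1
  rw [← e2] at c2
  rw [← e3] at c3
  linarith

end JointEntropy

/-- If `(X, Y, Z)` are jointly `d`-Markov, then for every `i ≥ 1` and
`k ≥ 1`, the per-time-step partial directed information term admits the finite-window
representation
`I(X_i ; Y_{i-k}^i ∣ X^{i-1}, Y^{i-k-1}, Z^i)
  = H(X_i ∣ X_{i-k-d}^{i-1}, Y_{i-k-d}^{i-k-1}, Z_{i-k-d}^i)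
    - H(X_i ∣ X_{i-d}^{i-1}, Y_{i-d}^i, Z_{i-d}^i)`. -/
theorem pdi_term_finite_window
    [MeasurableSpace Ω] (μ : Measure Ω) [IsProbabilityMeasure μ]
    [MeasurableSpace 𝒳] [MeasurableSingletonClass 𝒳] [Fintype 𝒳]
    [MeasurableSpace 𝒴] [MeasurableSingletonClass 𝒴] [Fintype 𝒴]
    [MeasurableSpace 𝒵] [MeasurableSingletonClass 𝒵] [Fintype 𝒵]
    (X : ℕ → Ω → 𝒳) (Y : ℕ → Ω → 𝒴) (Z : ℕ → Ω → 𝒵)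
    (hX : ∀ i, Measurable (X i)) (hY : ∀ i, Measurable (Y i))
    (hZ : ∀ i, Measurable (Z i)) (d : ℕ)
    (hmarkov : JointlyMarkov μ X Y Z d) :
    ∀ (i k : ℕ), 1 ≤ i → 1 ≤ k →
      cmi μ (X i) (blk Y (i - k) i)
          (fun ω => (blk X 1 (i - 1) ω, blk Y 1 (i - k - 1) ω, blk Z 1 i ω))
        = condEnt μ (X i)
            (fun ω => (blk X (i - k - d) (i - 1) ω, blk Y (i - k - d) (i - k - 1) ω,
              blk Z (i - k - d) i ω))
          - condEnt μ (X i)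
              (fun ω => (blk X (i - d) (i - 1) ω, blk Y (i - d) i ω, blk Z (i - d) i ω)) := by
  intro i k hi hk
  have hsub := ent_jointRV_submodular μ hX hY hZ
  have hmar := fun j hj => hmarkov.ent_increment_eq hX hY hZ (j := j) hj
  have hfar := markov_increment_eq (h := fun s => ent μ (jointRV X Y Z s)) hsub hmar
    (a := i - k) (i := i) (by omega)
    (s := (window (i - k - d) (i - 1), window (i - k - d) (i - k - 1), window (i - k - d) i))
    (x := ({i}, ∅, ∅))
    ⟨window_mono le_rfl (by omega), window_mono le_rfl le_rfl, window_mono le_rfl (by omega)⟩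
    (by
      refine ⟨?_, ?_, ?_⟩ <;> intro x <;> simp [window₃] <;> omega)
  have hnear := markov_increment_eq (h := fun s => ent μ (jointRV X Y Z s)) hsub hmar
    (a := i) (i := i) le_rfl
    (s := (window (i - d) (i - 1), window (i - d) i, window (i - d) i)) (x := ({i}, ∅, ∅))
    ⟨window_mono le_rfl le_rfl, window_mono le_rfl (by omega), window_mono le_rfl (by omega)⟩
    (by
      refine ⟨?_, ?_, ?_⟩ <;> intro x <;> simp [window₃]
      omega)
  beta_reduce at hfar hnear
  rw [sup_right_comm] at hfar hnear
  rw [cmi,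
    condEnt_eq_ent_jointRV (Y := Y) (Z := Z) μ i (s := (window (i - k - d) (i - 1),
      window (i - k - d) (i - k - 1), window (i - k - d) i) ⊔ window₃ 1 (i - k - 1)),
    condEnt_eq_ent_jointRV (Y := Y) (Z := Z) μ i (s := (window (i - d) (i - 1),
      window (i - d) i, window (i - d) i) ⊔ window₃ 1 (i - 1)),
    condEnt_eq_ent_jointRV (Y := Y) (Z := Z) μ i (s := (window (i - k - d) (i - 1),
      window (i - k - d) (i - k - 1), window (i - k - d) i)),
    condEnt_eq_ent_jointRV (Y := Y) (Z := Z) μ i (s := (window (i - d) (i - 1),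
      window (i - d) i, window (i - d) i)), hfar, hnear]
  · intro ω ω'
    rw [jointRV_eq_iff]
    simp only [Prod.mk.injEq, blk_eq_iff]
  · intro ω ω'
    rw [jointRV_eq_iff]
    simp only [Prod.mk.injEq, blk_eq_iff]
  · intro ω ω'
    have e : (window (i - d) (i - 1), window (i - d) i, window (i - d) i) ⊔ window₃ 1 (i - 1)
        = (window 1 (i - 1), window (i - k) i ∪ window 1 (i - k - 1), window 1 i) := by
      ext x <;> simp [window₃] <;> omega
    rw [e]
    rw [jointRV_eq_iff]
    simp only [Prod.mk.injEq, blk_eq_iff, Finset.mem_union, or_imp, forall_and]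
    tauto
  · intro ω ω'
    have e : (window (i - k - d) (i - 1), window (i - k - d) (i - k - 1), window (i - k - d) i)
        ⊔ window₃ 1 (i - k - 1) = (window 1 (i - 1), window 1 (i - k - 1), window 1 i) := by
      ext x <;> simp [window₃] <;> omega
    rw [e]
    rw [jointRV_eq_iff]
    simp only [Prod.mk.injEq, blk_eq_iff]
end
end

section
/- Let (X, Y, Z) be finite-alphabet stochastic processes on a common probability space that are jointly d-Markov, and suppose in addition that X is conditionally d-Markov given Z, i.e., H(X_i | X^{i−1}, Z^i) = H(X_i | X_{i−d}^{i−1}, Z_{i−d}^i) for every i. Then for every n ≥ 1 and every k ≥ d, the truncated directed information equals the directed information: I_T^{(k)}(Y^n → X^n || Z^n) = I(Y^n → X^n || Z^n). -/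
open MeasureTheory Finset

noncomputable section

variable {Ω : Type*}

variable {𝒳 𝒴 𝒵 : Type*}

section FiniteEntropy

open Classical in
/-- The mass of the fibre of `f` over `b`, for the weight `p` on a finite type. -/
def fiberMass {σ β : Type*} [Fintype σ] (p : σ → ℝ) (f : σ → β) (b : β) : ℝ :=
  ∑ s, if f s = b then p s else 0

/-- The Shannon entropy of `f` under the weight `p` on a finite type. -/
def fiberEnt {σ β : Type*} [Fintype σ] (p : σ → ℝ) (f : σ → β) : ℝ :=
  -∑ s, p s * Real.log (fiberMass p f (f s))

variable {σ β γ δ : Type*} [Fintype σ] {p : σ → ℝ}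

lemma fiberMass_nonneg (hp : ∀ s, 0 ≤ p s) (f : σ → β) (b : β) : 0 ≤ fiberMass p f b :=
  sum_nonneg fun s _ => by split_ifs <;> simp [hp s]

lemma le_fiberMass (hp : ∀ s, 0 ≤ p s) (f : σ → β) (s : σ) : p s ≤ fiberMass p f (f s) := by
  classical
  have h := single_le_sum (s := univ) (f := fun t => if f t = f s then p t else 0)
    (fun t _ => by split_ifs <;> simp [hp t]) (mem_univ s)
  simp only [if_true] at h
  unfold fiberMass
  convert h

lemma fiberEnt_congr {f : σ → β} {g : σ → γ} (h : ∀ s t, f s = f t ↔ g s = g t) :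
    fiberEnt p f = fiberEnt p g := by
  classical
  have hmass : ∀ s, fiberMass p f (f s) = fiberMass p g (g s) := fun s => by
    unfold fiberMass
    exact sum_congr rfl fun t _ => if_congr (h t s) rfl rfl
  simp only [fiberEnt, hmass]

/-- Submodularity of entropy. -/
lemma fiberEnt_submodular (hp : ∀ s, 0 ≤ p s) (hp1 : ∑ s, p s = 1)
    (u : σ → β) (v : σ → γ) (w : σ → δ) :
    fiberEnt p (fun s => (u s, v s, w s)) + fiberEnt p w
      ≤ fiberEnt p (fun s => (u s, w s)) + fiberEnt p (fun s => (v s, w s)) := by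
  classical
  set mA : σ → ℝ := fun s => fiberMass p (fun s => (u s, v s, w s)) (u s, v s, w s) with hA
  set mW : σ → ℝ := fun s => fiberMass p w (w s) with hW
  set mU : σ → ℝ := fun s => fiberMass p (fun s => (u s, w s)) (u s, w s) with hU
  set mV : σ → ℝ := fun s => fiberMass p (fun s => (v s, w s)) (v s, w s) with hV
  have key : ∀ s, p s - p s * (mU s * mV s / (mA s * mW s)) ≤
      p s * Real.log (mA s) + p s * Real.log (mW s)
        - p s * Real.log (mU s) - p s * Real.log (mV s) := by
    intro s
    rcases (hp s).eq_or_lt with h | h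
    · simp [← h]
    have a1 : 0 < mA s := h.trans_le (le_fiberMass hp (fun s => (u s, v s, w s)) s)
    have a2 : 0 < mW s := h.trans_le (le_fiberMass hp w s)
    have a3 : 0 < mU s := h.trans_le (le_fiberMass hp (fun s => (u s, w s)) s)
    have a4 : 0 < mV s := h.trans_le (le_fiberMass hp (fun s => (v s, w s)) s)
    have hl := Real.log_le_sub_one_of_pos (x := mU s * mV s / (mA s * mW s)) (by positivity)
    rw [Real.log_div (by positivity) (by positivity), Real.log_mul a3.ne' a4.ne',
      Real.log_mul a1.ne' a2.ne'] at hl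
    nlinarith
  have inner : ∀ r t, (∑ s, if u t = u s ∧ v r = v s ∧ w t = w s ∧ w r = w s then
      p s / (mA s * mW s) else 0) ≤ if w t = w r then (mW r)⁻¹ else 0 := by
    intro r t
    split_ifs with h
    · set m := fiberMass p (fun s => (u s, v s, w s)) (u t, v r, w r) with hm
      have : (∑ s, if u t = u s ∧ v r = v s ∧ w t = w s ∧ w r = w s then
          p s / (mA s * mW s) else 0) = m / m * (mW r)⁻¹ := by
        conv_rhs => enter [1, 1]; rw [hm, fiberMass]
        rw [sum_div, sum_mul]
        refine sum_congr rfl fun s _ => ?_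
        by_cases hc : u t = u s ∧ v r = v s ∧ w t = w s ∧ w r = w s
        · rw [if_pos hc, if_pos (by simp [hc])]
          simp only [hA, hW, hm, hc]
          rw [div_mul_eq_div_div, div_eq_mul_inv _ (fiberMass p w (w s))]
        · rw [if_neg hc, if_neg (by grind)]
          simp
      rw [this]
      have hw : 0 ≤ (mW r)⁻¹ := inv_nonneg.2 (fiberMass_nonneg hp _ _)
      exact mul_le_of_le_one_left hw (div_self_le_one m)
    · refine (sum_eq_zero fun s _ => ?_).le
      rw [if_neg (by grind)]
  have total : ∑ s, p s * (mU s * mV s / (mA s * mW s)) ≤ 1 := by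
    calc ∑ s, p s * (mU s * mV s / (mA s * mW s))
        = ∑ s, ∑ r, ∑ t, p r * (p t *
            if u t = u s ∧ v r = v s ∧ w t = w s ∧ w r = w s then
              p s / (mA s * mW s) else 0) := by
          refine sum_congr rfl fun s _ => ?_
          have : p s * (mU s * mV s / (mA s * mW s)) = mV s * mU s * (p s / (mA s * mW s)) := by
            ring
          rw [this]
          simp only [hU, hV, fiberMass]
          rw [sum_mul_sum, sum_mul]
          refine sum_congr rfl fun r _ => ?_
          rw [sum_mul]
          refine sum_congr rfl fun t _ => ?_
          simp only [Prod.mk.injEq]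
          split_ifs <;> first | ring1 | grind
      _ = ∑ r, ∑ t, p r * (p t * ∑ s,
            if u t = u s ∧ v r = v s ∧ w t = w s ∧ w r = w s then
              p s / (mA s * mW s) else 0) := by
          rw [sum_comm]
          refine sum_congr rfl fun r _ => ?_
          rw [sum_comm]
          simp only [mul_sum]
      _ ≤ ∑ r, ∑ t, p r * (p t * if w t = w r then (mW r)⁻¹ else 0) := by
          gcongr with r _ t _
          · exact hp r
          · exact hp t
          · exact inner r t
      _ = ∑ r, p r * (mW r / mW r) := by
          refine sum_congr rfl fun r _ => ?_
          rw [← mul_sum, div_eq_mul_inv]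
          conv_rhs => enter [2, 1]; rw [hW]
          simp only [fiberMass, sum_mul]
          congr 1
          refine sum_congr rfl fun t _ => ?_
          split_ifs <;> simp
      _ ≤ ∑ r, p r := by
          gcongr with r _
          exact mul_le_of_le_one_right (hp r) (div_self_le_one _)
      _ = 1 := hp1
  have := sum_le_sum fun s (_ : s ∈ univ) => key s
  simp only [sum_sub_distrib, sum_add_distrib, hp1] at this
  simp only [fiberEnt]
  linarith

lemma fiberEnt_modular (hp : ∀ s, 0 ≤ p s)
    (u : σ → β) (v : σ → γ) (w : σ → δ)
    (h : ∀ b c d, fiberMass p (fun s => (u s, v s, w s)) (b, c, d) * fiberMass p w d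
      = fiberMass p (fun s => (u s, w s)) (b, d) * fiberMass p (fun s => (v s, w s)) (c, d)) :
    fiberEnt p (fun s => (u s, v s, w s)) + fiberEnt p w
      = fiberEnt p (fun s => (u s, w s)) + fiberEnt p (fun s => (v s, w s)) := by
  simp only [fiberEnt, ← neg_add, ← sum_add_distrib, ← mul_add]
  congr 1
  refine sum_congr rfl fun s _ => ?_
  rcases (hp s).eq_or_lt with h0 | h0
  · simp [← h0]
  have a1 := h0.trans_le (le_fiberMass hp (fun s => (u s, v s, w s)) s)
  have a2 := h0.trans_le (le_fiberMass hp w s)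
  have a3 := h0.trans_le (le_fiberMass hp (fun s => (u s, w s)) s)
  have a4 := h0.trans_le (le_fiberMass hp (fun s => (v s, w s)) s)
  rw [← Real.log_mul a1.ne' a2.ne', ← Real.log_mul a3.ne' a4.ne', h]

end FiniteEntropy

section Entropy

lemma factorsThrough_prodMk {σ β γ : Type*} {S : Ω → σ} {U : Ω → β}
    {V : Ω → γ} (hU : U.FactorsThrough S) (hV : V.FactorsThrough S) :
    (fun ω => (U ω, V ω)).FactorsThrough S :=
  fun _ _ h => Prod.ext (hU h) (hV h)

variable {σ β γ δ : Type*} [MeasurableSpace Ω] {μ : Measure Ω} [Fintype σ]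
  {S : Ω → σ} {r : σ → Ω}

lemma fiberMass_eq_measure [IsFiniteMeasure μ] (hS : ∀ s, MeasurableSet (S ⁻¹' {s}))
    (hr : Function.RightInverse r S) {U : Ω → β} (hU : U.FactorsThrough S) (b : β) :
    fiberMass (fun s => (μ (S ⁻¹' {s})).toReal) (U ∘ r) b = (μ (U ⁻¹' {b})).toReal := by
  classical
  have hpre : U ⁻¹' {b} = S ⁻¹' (univ.filter fun s => U (r s) = b : Finset σ) := by
    ext ω
    simp [hU (hr (S ω))]
  rw [hpre, ← sum_measure_preimage_singleton _ fun s _ => hS s,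
    ENNReal.toReal_sum fun s _ => measure_ne_top _ _, sum_filter]
  unfold fiberMass
  exact sum_congr rfl fun s _ => by simp

lemma ent_eq_fiberEnt [IsFiniteMeasure μ] (hS : ∀ s, MeasurableSet (S ⁻¹' {s}))
    (hr : Function.RightInverse r S) {U : Ω → β} (hU : U.FactorsThrough S) :
    ent μ U = fiberEnt (fun s => (μ (S ⁻¹' {s})).toReal) (U ∘ r) := by
  classical
  unfold ent fiberEnt
  congr 1
  simp only [← fiberMass_eq_measure hS hr hU]
  rw [tsum_eq_sum (s := univ.image (U ∘ r))]
  · refine sum_image' _ fun s _ => ?_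
    conv_lhs => enter [1]; rw [fiberMass]
    rw [sum_mul, sum_filter]
    refine sum_congr rfl fun t _ => ?_
    split_ifs with h
    · rw [h]
    · simp
  · intro b hb
    have : fiberMass (fun s => (μ (S ⁻¹' {s})).toReal) (U ∘ r) b = 0 := by
      refine sum_eq_zero fun s _ => if_neg fun h => hb ?_
      exact mem_image.2 ⟨s, mem_univ s, h⟩
    simp [this]

lemma ent_congr_s7 [IsFiniteMeasure μ] (hS : ∀ s, MeasurableSet (S ⁻¹' {s}))
    (hr : Function.RightInverse r S) {U : Ω → β} {V : Ω → γ} (hU : U.FactorsThrough S)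
    (h : ∀ ω ω', U ω = U ω' ↔ V ω = V ω') : ent μ U = ent μ V := by
  have hV : V.FactorsThrough S := fun ω ω' hω => (h ω ω').1 (hU hω)
  rw [ent_eq_fiberEnt hS hr hU, ent_eq_fiberEnt hS hr hV]
  exact fiberEnt_congr fun s t => h (r s) (r t)

/-- Conditioning on more reduces entropy. -/
lemma condEnt_le_condEnt [IsProbabilityMeasure μ] (hS : ∀ s, MeasurableSet (S ⁻¹' {s}))
    (hr : Function.RightInverse r S) {U : Ω → β} {V : Ω → γ} {W : Ω → δ}
    (hU : U.FactorsThrough S) (hV : V.FactorsThrough S) (hVW : W.FactorsThrough V) :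
    condEnt μ U V ≤ condEnt μ U W := by
  have hW : W.FactorsThrough S := fun _ _ h => hVW (hV h)
  have hp1 : ∑ s, (μ (S ⁻¹' {s})).toReal = 1 := by
    rw [← ENNReal.toReal_sum fun s _ => measure_ne_top _ _,
      sum_measure_preimage_singleton _ fun s _ => hS s]
    simp
  have key := fiberEnt_submodular (p := fun s => (μ (S ⁻¹' {s})).toReal)
    (fun s => ENNReal.toReal_nonneg) hp1 (U ∘ r) (V ∘ r) (W ∘ r)
  have e1 := ent_eq_fiberEnt (μ := μ) hS hr
    (factorsThrough_prodMk hU (factorsThrough_prodMk hV hW))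
  have e2 := ent_eq_fiberEnt (μ := μ) hS hr hW
  have e3 := ent_eq_fiberEnt (μ := μ) hS hr (factorsThrough_prodMk hU hW)
  have e4 := ent_eq_fiberEnt (μ := μ) hS hr (factorsThrough_prodMk hV hW)
  simp only [Function.comp_def] at key e1 e2 e3 e4
  rw [← e1, ← e2, ← e3, ← e4] at key
  have c1 : ent μ (fun ω => (U ω, V ω)) = ent μ (fun ω => (U ω, V ω, W ω)) :=
    ent_congr_s7 hS hr (factorsThrough_prodMk hU hV) fun ω ω' => by
      simp only [Prod.mk.injEq]
      exact ⟨fun h => ⟨h.1, h.2, hVW h.2⟩, fun h => ⟨h.1, h.2.1⟩⟩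
  have c2 : ent μ V = ent μ (fun ω => (V ω, W ω)) :=
    ent_congr_s7 hS hr hV fun ω ω' => by
      simp only [Prod.mk.injEq]
      exact ⟨fun h => ⟨h, hVW h⟩, fun h => h.1⟩
  unfold condEnt
  linarith

lemma CondIndepRV.ent_add_ent [IsFiniteMeasure μ] (hS : ∀ s, MeasurableSet (S ⁻¹' {s}))
    (hr : Function.RightInverse r S) {U : Ω → β} {V : Ω → γ} {W : Ω → δ}
    (hU : U.FactorsThrough S) (hV : V.FactorsThrough S) (hW : W.FactorsThrough S)
    (h : CondIndepRV μ U V W) :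
    ent μ (fun ω => (U ω, V ω, W ω)) + ent μ W
      = ent μ (fun ω => (U ω, W ω)) + ent μ (fun ω => (V ω, W ω)) := by
  have hA := factorsThrough_prodMk hU (factorsThrough_prodMk hV hW)
  have hUW := factorsThrough_prodMk hU hW
  have hVW := factorsThrough_prodMk hV hW
  rw [ent_eq_fiberEnt hS hr hA, ent_eq_fiberEnt hS hr hW, ent_eq_fiberEnt hS hr hUW,
    ent_eq_fiberEnt hS hr hVW]
  refine fiberEnt_modular (fun s => ENNReal.toReal_nonneg) (U ∘ r) (V ∘ r) (W ∘ r)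
    fun b c d => ?_
  have e1 := fiberMass_eq_measure (μ := μ) hS hr hA (b, c, d)
  have e2 := fiberMass_eq_measure (μ := μ) hS hr hW d
  have e3 := fiberMass_eq_measure (μ := μ) hS hr hUW (b, d)
  have e4 := fiberMass_eq_measure (μ := μ) hS hr hVW (c, d)
  simp only [Function.comp_def] at e1 e2 e3 e4 ⊢
  rw [e1, e2, e3, e4, ← ENNReal.toReal_mul, ← ENNReal.toReal_mul]
  have := h b c d
  rw [Set.inter_assoc] at this
  simp only [← Set.singleton_prod_singleton, Set.mk_preimage_prod]
  rw [this]

lemma CondIndepRV.comp_left {α : Type*} [Fintype β] {U : Ω → β} {V : Ω → γ} {W : Ω → δ}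
    (h : CondIndepRV μ U V W) (hU : ∀ b, MeasurableSet (U ⁻¹' {b})) (g : β → α) :
    CondIndepRV μ (fun ω => g (U ω)) V W := by
  classical
  intro a c w
  have hsum : ∀ E : Set Ω, μ ((fun ω => g (U ω)) ⁻¹' {a} ∩ E)
      = ∑ b with g b = a, μ (U ⁻¹' {b} ∩ E) := by
    intro E
    have hpre : (fun ω => g (U ω)) ⁻¹' {a} = U ⁻¹' (univ.filter fun b => g b = a : Finset β) := by
      ext ω
      simp
    have hmeas : MeasurableSet (U ⁻¹' (univ.filter fun b => g b = a : Finset β)) := by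
      rw [← Set.biUnion_preimage_singleton]
      exact Finset.measurableSet_biUnion _ fun b _ => hU b
    rw [hpre, ← Measure.restrict_apply hmeas, ← sum_measure_preimage_singleton _ fun b _ => hU b]
    exact sum_congr rfl fun b _ => Measure.restrict_apply (hU b)
  rw [Set.inter_assoc, hsum, hsum, sum_mul, sum_mul]
  refine sum_congr rfl fun b _ => ?_
  rw [← Set.inter_assoc]
  exact h b c w

end Entropy

lemma blk_eq_blk_iff {α : Type*} {X : ℕ → Ω → α} {a b : ℕ} {ω ω' : Ω} :
    blk X a b ω = blk X a b ω' ↔ ∀ j, a ≤ j → 1 ≤ j → j ≤ b → X j ω = X j ω' := by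
  simp only [blk, funext_iff]
  refine forall_congr' fun j => ?_
  by_cases h : max a 1 ≤ j ∧ j ≤ b
  · have := max_le_iff.1 h.1
    simp [h, this]
  · rw [if_neg h, if_neg h]
    simp only [true_iff]
    exact fun h1 h2 h3 => absurd ⟨max_le h1 h2, h3⟩ h

/-- If `(X, Y, Z)` are jointly `d`-Markov and `X` is conditionally
`d`-Markov given `Z` (i.e. `H(X_i ∣ X^{i-1}, Z^i) = H(X_i ∣ X_{i-d}^{i-1}, Z_{i-d}^i)`
for every `i`), then for every `n ≥ 1` and `k ≥ d` the truncated directed information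
equals the directed information:
`I_T^{(k)}(Y^n → X^n ‖ Z^n) = I(Y^n → X^n ‖ Z^n)`. -/
theorem tdi_eq_di_of_cond_markov
    [MeasurableSpace Ω] (μ : Measure Ω) [IsProbabilityMeasure μ]
    [MeasurableSpace 𝒳] [MeasurableSingletonClass 𝒳] [Fintype 𝒳]
    [MeasurableSpace 𝒴] [MeasurableSingletonClass 𝒴] [Fintype 𝒴]
    [MeasurableSpace 𝒵] [MeasurableSingletonClass 𝒵] [Fintype 𝒵]
    (X : ℕ → Ω → 𝒳) (Y : ℕ → Ω → 𝒴) (Z : ℕ → Ω → 𝒵)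
    (hX : ∀ i, Measurable (X i)) (hY : ∀ i, Measurable (Y i))
    (hZ : ∀ i, Measurable (Z i)) (d : ℕ)
    (hmarkov : JointlyMarkov μ X Y Z d)
    (hcond : ∀ i : ℕ, 1 ≤ i →
      condEnt μ (X i) (fun ω => (blk X 1 (i - 1) ω, blk Z 1 i ω))
        = condEnt μ (X i) (fun ω => (blk X (i - d) (i - 1) ω, blk Z (i - d) i ω))) :
    ∀ (n k : ℕ), 1 ≤ n → d ≤ k → TDI μ X Y Z k n = DI μ X Y Z n := by
  intro n k _ hdk
  refine sum_congr rfl fun i hi => ?_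
  have hi1 : 1 ≤ i := (mem_Icc.1 hi).1
  let S₀ : Ω → (Fin (i + 1) → 𝒳 × 𝒴 × 𝒵) := fun ω j => (X j ω, Y j ω, Z j ω)
  have hS₀ : Measurable S₀ :=
    measurable_pi_lambda _ fun j => (hX j).prodMk ((hY j).prodMk (hZ j))
  let S : Ω → Set.range S₀ := Set.rangeFactorization S₀
  have : Fintype (Set.range S₀) := Fintype.ofFinite _
  have hS : ∀ s, MeasurableSet (S ⁻¹' {s}) := fun s => by
    have : S ⁻¹' {s} = S₀ ⁻¹' {(s : Fin (i + 1) → 𝒳 × 𝒴 × 𝒵)} := by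
      ext ω
      simp [S, Set.rangeFactorization, Subtype.ext_iff]
    rw [this]
    exact hS₀ (measurableSet_singleton _)
  obtain ⟨r, hr⟩ := (Set.rangeFactorization_surjective (f := S₀)).hasRightInverse
  have hSval : ∀ {ω ω'}, S ω = S ω' →
      ∀ j ≤ i, X j ω = X j ω' ∧ Y j ω = Y j ω' ∧ Z j ω = Z j ω' := by
    intro ω ω' h j hj
    have := congrFun (congrArg Subtype.val h) ⟨j, by omega⟩
    simpa [S, S₀, Set.rangeFactorization] using this
  have hXi : (X i).FactorsThrough S := fun ω ω' h => (hSval h i le_rfl).1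
  have hYi : (Y i).FactorsThrough S := fun ω ω' h => (hSval h i le_rfl).2.1
  have hZi : (Z i).FactorsThrough S := fun ω ω' h => (hSval h i le_rfl).2.2
  have hbX : ∀ a b, b ≤ i → (blk X a b).FactorsThrough S := fun a b hb ω ω' h =>
    blk_eq_blk_iff.2 fun j _ _ hj => (hSval h j (hj.trans hb)).1
  have hbY : ∀ a b, b ≤ i → (blk Y a b).FactorsThrough S := fun a b hb ω ω' h =>
    blk_eq_blk_iff.2 fun j _ _ hj => (hSval h j (hj.trans hb)).2.1
  have hbZ : ∀ a b, b ≤ i → (blk Z a b).FactorsThrough S := fun a b hb ω ω' h =>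
    blk_eq_blk_iff.2 fun j _ _ hj => (hSval h j (hj.trans hb)).2.2
  have hXZ : ∀ a, (fun ω => (blk X a (i - 1) ω, blk Z a i ω)).FactorsThrough S := fun a =>
    factorsThrough_prodMk (hbX _ _ (by omega)) (hbZ _ _ le_rfl)
  have hYXZ : ∀ a,
      (fun ω => (blk Y a i ω, blk X a (i - 1) ω, blk Z a i ω)).FactorsThrough S := fun a =>
    factorsThrough_prodMk (hbY _ _ le_rfl) (hXZ a)
  have mono : ∀ a a', a ≤ a' ∨ a ≤ 1 →
      condEnt μ (X i) (fun ω => (blk X a (i - 1) ω, blk Z a i ω))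
        ≤ condEnt μ (X i) (fun ω => (blk X a' (i - 1) ω, blk Z a' i ω)) := fun a a' ha =>
    condEnt_le_condEnt hS hr hXi (hXZ a) fun ω ω' h => by
      simp only [Prod.mk.injEq, blk_eq_blk_iff] at h ⊢
      grind
  have monoY : ∀ a a', a ≤ a' ∨ a ≤ 1 →
      condEnt μ (X i) (fun ω => (blk Y a i ω, blk X a (i - 1) ω, blk Z a i ω))
        ≤ condEnt μ (X i) (fun ω => (blk Y a' i ω, blk X a' (i - 1) ω, blk Z a' i ω)) :=
    fun a a' ha => condEnt_le_condEnt hS hr hXi (hYXZ a) fun ω ω' h => by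
      simp only [Prod.mk.injEq, blk_eq_blk_iff] at h ⊢
      grind
  have hfull : condEnt μ (X i) (fun ω => (blk Y 1 i ω, blk X 1 (i - 1) ω, blk Z 1 i ω))
      = condEnt μ (X i)
        (fun ω => (blk Y (i - d) i ω, blk X (i - d) (i - 1) ω, blk Z (i - d) i ω)) := by
    have hXYZ := factorsThrough_prodMk hXi (factorsThrough_prodMk hYi hZi)
    have hYZ := factorsThrough_prodMk hYi hZi
    have hP : (fun ω => (blk X 1 (i - d - 1) ω, blk Y 1 (i - d - 1) ω,
        blk Z 1 (i - d - 1) ω)).FactorsThrough S :=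
      factorsThrough_prodMk (hbX _ _ (by omega))
        (factorsThrough_prodMk (hbY _ _ (by omega)) (hbZ _ _ (by omega)))
    have hW : (past X Y Z d i).FactorsThrough S :=
      factorsThrough_prodMk (hbX _ _ (by omega))
        (factorsThrough_prodMk (hbY _ _ (by omega)) (hbZ _ _ (by omega)))
    have hm := hmarkov i hi1
    have e1 := hm.ent_add_ent hS hr hXYZ hP hW
    have e2 := (hm.comp_left (fun b =>
      ((hX i).prodMk ((hY i).prodMk (hZ i))) (measurableSet_singleton b)) Prod.snd).ent_add_ent
        hS hr hYZ hP hW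
    have c1 := ent_congr_s7 (μ := μ) hS hr (factorsThrough_prodMk hXi (hYXZ 1))
      (V := fun ω => ((X i ω, Y i ω, Z i ω), (blk X 1 (i - d - 1) ω, blk Y 1 (i - d - 1) ω,
        blk Z 1 (i - d - 1) ω), past X Y Z d i ω)) fun ω ω' => by
      simp only [past, Prod.mk.injEq, blk_eq_blk_iff]
      grind
    have c2 := ent_congr_s7 (μ := μ) hS hr (hYXZ 1)
      (V := fun ω => ((Y i ω, Z i ω), (blk X 1 (i - d - 1) ω, blk Y 1 (i - d - 1) ω,
        blk Z 1 (i - d - 1) ω), past X Y Z d i ω)) fun ω ω' => by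
      simp only [past, Prod.mk.injEq, blk_eq_blk_iff]
      grind
    have c3 := ent_congr_s7 (μ := μ) hS hr (factorsThrough_prodMk hXi (hYXZ (i - d)))
      (V := fun ω => ((X i ω, Y i ω, Z i ω), past X Y Z d i ω)) fun ω ω' => by
      simp only [past, Prod.mk.injEq, blk_eq_blk_iff]
      grind
    have c4 := ent_congr_s7 (μ := μ) hS hr (hYXZ (i - d))
      (V := fun ω => ((Y i ω, Z i ω), past X Y Z d i ω)) fun ω ω' => by
      simp only [past, Prod.mk.injEq, blk_eq_blk_iff]
      grind
    unfold condEnt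
    rw [c1, c2, c3, c4]
    linarith
  have h1 : condEnt μ (X i) (fun ω => (blk X (i - k) (i - 1) ω, blk Z (i - k) i ω))
      = condEnt μ (X i) (fun ω => (blk X 1 (i - 1) ω, blk Z 1 i ω)) :=
    le_antisymm ((mono _ _ (Or.inl (by omega))).trans (hcond i hi1).ge)
      (mono _ _ (Or.inr le_rfl))
  have h2 : condEnt μ (X i)
        (fun ω => (blk Y (i - k) i ω, blk X (i - k) (i - 1) ω, blk Z (i - k) i ω))
      = condEnt μ (X i) (fun ω => (blk Y 1 i ω, blk X 1 (i - 1) ω, blk Z 1 i ω)) :=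
    le_antisymm ((monoY _ _ (Or.inl (by omega))).trans hfull.ge) (monoY _ _ (Or.inr le_rfl))
  unfold cmi
  rw [h1, h2]
end
end
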